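/- If there is a constant ā > 0 such that ‖Φ(t,τ)‖ ≤ ā for all 1 ≤ τ ≤ t+1 (where Φ(t,τ) := A(t)·A(t−1)⋯A(τ) for τ ≤ t and Φ(t,t+1) := I), then for every t ≥ 1, ‖Σ(t)‖ ≤ ā²·‖Σ(0)‖ + ā²·‖Σ_θ‖·Σ_{τ=1}^t ‖B(τ)‖². -/

import Mathlib

open Matrix Finset

/-- The ordered product `Φ(t,τ) = A(t)·A(t−1)⋯A(τ)` for `τ ≤ t`, with `Φ(t,t+1) = I`. -/
def matProd (m : ℕ) (A : ℕ → Matrix (Fin m) (Fin m) ℝ) (t τ : ℕ) :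
    Matrix (Fin m) (Fin m) ℝ :=
  (((List.range' τ (t + 1 - τ)).reverse).map A).prod

/-- The operator norm of a real matrix induced by the Euclidean norm. -/
noncomputable def matOpNorm {a b : ℕ} (M : Matrix (Fin a) (Fin b) ℝ) : ℝ :=
  ‖LinearMap.toContinuousLinearMap (Matrix.toEuclideanLin M)‖

open scoped Matrix.Norms.L2Operator in
lemma matOpNorm_eq {a b : ℕ} (M : Matrix (Fin a) (Fin b) ℝ) : matOpNorm M = ‖M‖ := by
  rw [Matrix.l2_opNorm_def]; rfl

lemma matOpNorm_nonneg {a b : ℕ} (M : Matrix (Fin a) (Fin b) ℝ) : 0 ≤ matOpNorm M :=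
  norm_nonneg _

open scoped Matrix.Norms.L2Operator in
lemma matOpNorm_mul {a b c : ℕ} (M : Matrix (Fin a) (Fin b) ℝ) (N : Matrix (Fin b) (Fin c) ℝ) :
    matOpNorm (M * N) ≤ matOpNorm M * matOpNorm N := by
  simp only [matOpNorm_eq]; exact Matrix.l2_opNorm_mul M N

open scoped Matrix.Norms.L2Operator in
lemma matOpNorm_add {a b : ℕ} (M N : Matrix (Fin a) (Fin b) ℝ) :
    matOpNorm (M + N) ≤ matOpNorm M + matOpNorm N := by
  simp only [matOpNorm_eq]; exact norm_add_le M N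

open scoped Matrix.Norms.L2Operator in
lemma matOpNorm_sum {a b : ℕ} (s : Finset ℕ) (f : ℕ → Matrix (Fin a) (Fin b) ℝ) :
    matOpNorm (∑ i ∈ s, f i) ≤ ∑ i ∈ s, matOpNorm (f i) := by
  simp only [matOpNorm_eq]; exact norm_sum_le s f

open scoped Matrix.Norms.L2Operator in
lemma matOpNorm_transpose {a b : ℕ} (M : Matrix (Fin a) (Fin b) ℝ) :
    matOpNorm Mᵀ = matOpNorm M := by
  simp only [matOpNorm_eq]
  rw [← Matrix.conjTranspose_eq_transpose_of_trivial, Matrix.l2_opNorm_conjTranspose]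

lemma matOpNorm_sandwich {a b : ℕ} (M : Matrix (Fin a) (Fin b) ℝ) (N : Matrix (Fin b) (Fin b) ℝ) :
    matOpNorm (M * N * Mᵀ) ≤ matOpNorm M ^ 2 * matOpNorm N := by
  calc _ ≤ matOpNorm (M * N) * matOpNorm Mᵀ := matOpNorm_mul _ _
    _ ≤ (matOpNorm M * matOpNorm N) * matOpNorm Mᵀ :=
        mul_le_mul_of_nonneg_right (matOpNorm_mul _ _) (matOpNorm_nonneg _)
    _ = _ := by rw [matOpNorm_transpose]; ring

lemma matProd_self (m : ℕ) (A : ℕ → Matrix (Fin m) (Fin m) ℝ) (t : ℕ) :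
    matProd m A t (t + 1) = 1 := by
  simp [matProd]

lemma matProd_succ (m : ℕ) (A : ℕ → Matrix (Fin m) (Fin m) ℝ) (t τ : ℕ) (h : τ ≤ t + 1) :
    matProd m A (t + 1) τ = A (t + 1) * matProd m A t τ := by
  have e : t + 1 + 1 - τ = (t + 1 - τ) + 1 := by omega
  have e2 : τ + (t + 1 - τ) = t + 1 := by omega
  simp [matProd, e, List.range'_concat, e2]

lemma S_closed (m q : ℕ)
    (A : ℕ → Matrix (Fin m) (Fin m) ℝ)
    (B : ℕ → Matrix (Fin m) (Fin q) ℝ)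
    (Sθ : Matrix (Fin q) (Fin q) ℝ)
    (S : ℕ → Matrix (Fin m) (Fin m) ℝ)
    (hrec : ∀ t : ℕ, 1 ≤ t → S t = A t * S (t - 1) * (A t)ᵀ + B t * Sθ * (B t)ᵀ) (t : ℕ) :
    S t = matProd m A t 1 * S 0 * (matProd m A t 1)ᵀ +
      ∑ τ ∈ Finset.Icc 1 t,
        matProd m A t (τ + 1) * (B τ * Sθ * (B τ)ᵀ) * (matProd m A t (τ + 1))ᵀ := by
  induction t with
  | zero => simp [matProd]
  | succ t ih =>
    rw [hrec (t + 1) (by omega), Nat.add_sub_cancel, ih, Finset.sum_Icc_succ_top (by omega),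
      matProd_self, matProd_succ m A t 1 (by omega)]
    have : ∑ τ ∈ Finset.Icc 1 t, matProd m A (t + 1) (τ + 1) * (B τ * Sθ * (B τ)ᵀ) *
          (matProd m A (t + 1) (τ + 1))ᵀ
        = A (t + 1) * (∑ τ ∈ Finset.Icc 1 t, matProd m A t (τ + 1) * (B τ * Sθ * (B τ)ᵀ) *
          (matProd m A t (τ + 1))ᵀ) * (A (t + 1))ᵀ := by
      rw [Finset.mul_sum, Finset.sum_mul]
      refine Finset.sum_congr rfl fun τ hτ => ?_
      have := (Finset.mem_Icc.mp hτ).2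
      rw [matProd_succ m A t (τ + 1) (by omega), Matrix.transpose_mul]
      simp only [Matrix.mul_assoc]
    rw [this, Matrix.transpose_mul]
    simp only [Matrix.mul_add, Matrix.add_mul, Matrix.mul_assoc, Matrix.transpose_one,
      Matrix.one_mul, Matrix.mul_one, add_assoc]

/-- If `‖Φ(t,τ)‖ ≤ ā` for all `1 ≤ τ ≤ t+1`, then for every `t ≥ 1`,
`‖Σ(t)‖ ≤ ā²·‖Σ(0)‖ + ā²·‖Σ_θ‖·∑_{τ=1}^t ‖B(τ)‖²`. -/
theorem covariance_norm_bound
    (m q : ℕ) (hm : 0 < m) (hq : 0 < q)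
    (A : ℕ → Matrix (Fin m) (Fin m) ℝ)
    (B : ℕ → Matrix (Fin m) (Fin q) ℝ)
    (Sθ : Matrix (Fin q) (Fin q) ℝ)
    (S : ℕ → Matrix (Fin m) (Fin m) ℝ)
    (hrec : ∀ t : ℕ, 1 ≤ t → S t = A t * S (t - 1) * (A t)ᵀ + B t * Sθ * (B t)ᵀ)
    (abar : ℝ) (habar : 0 < abar)
    (hΦ : ∀ t τ : ℕ, 1 ≤ τ → τ ≤ t + 1 → matOpNorm (matProd m A t τ) ≤ abar) :
    ∀ t : ℕ, 1 ≤ t →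
      matOpNorm (S t) ≤ abar ^ 2 * matOpNorm (S 0) +
        abar ^ 2 * matOpNorm Sθ * ∑ τ ∈ Finset.Icc 1 t, (matOpNorm (B τ)) ^ 2 := by
  intro t ht
  rw [S_closed m q A B Sθ S hrec t]
  refine (matOpNorm_add _ _).trans (add_le_add ?_ ?_)
  · refine (matOpNorm_sandwich _ _).trans ?_
    exact mul_le_mul_of_nonneg_right
      (pow_le_pow_left₀ (matOpNorm_nonneg _) (hΦ t 1 le_rfl (by omega)) 2) (matOpNorm_nonneg _)
  · refine (matOpNorm_sum _ _).trans ?_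
    rw [Finset.mul_sum]
    refine Finset.sum_le_sum fun τ hτ => ?_
    have h := (Finset.mem_Icc.mp hτ).2
    refine (matOpNorm_sandwich _ _).trans ?_
    calc _ ≤ abar ^ 2 * (matOpNorm (B τ) ^ 2 * matOpNorm Sθ) :=
          mul_le_mul (pow_le_pow_left₀ (matOpNorm_nonneg _) (hΦ t (τ + 1) (by omega) (by omega)) 2)
            (matOpNorm_sandwich _ _) (matOpNorm_nonneg _) (by positivity)
      _ = _ := by ring
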